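/- Fix λ ≥ 0 and x > 0. Let δ(·;λ) be the convex envelope on [0,1] of the left-continuous function φ(s−;λ) = (Φ([0, w⁻¹(s))) + λ w⁻¹(s))/(1+λ), and define H*(s) = (x/E[ξ]) · δ'₊(s;λ). Then ∫_0^1 H*(s) ds = x/E[ξ], and for every H ∈ 𝔾 with ∫_0^1 H(s) ds = x/E[ξ], one has J(H) ≤ J(H*), where J(H) = λ ∫_{[0,1)} ln H(w(u)) du + ∫_{[0,1)} ln H(w(u)) Φ(du), valued in [−∞, ∞) with the convention that the Φ-integral equals −∞ whenever H(w(s)) = 0 for some s ∈ [0,1] with Φ([0,s]) > 0. -/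

import Mathlib

open MeasureTheory ProbabilityTheory Set
open scoped ENNReal NNReal Classical

noncomputable section

/-- Quantile function `G_Y(z) = inf {y | F_Y(y) > z}` of `Y` under `μ`. -/
def qf {Ω : Type*} [MeasurableSpace Ω] (μ : Measure Ω) (Y : Ω → ℝ) (z : ℝ) : ℝ :=
  sInf {y : ℝ | z < (μ {ω | Y ω ≤ y}).toReal}

/-- The distorted identity `w(s) = (1/E[ξ]) ∫_0^s G_ξ(1-z) dz`. -/
def wDist {Ω : Type*} [MeasurableSpace Ω] (μ : Measure Ω) (ξ : Ω → ℝ) (s : ℝ) : ℝ :=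
  (∫ z in (0:ℝ)..s, qf μ ξ (1 - z)) / (∫ ω, ξ ω ∂μ)

/-- The inverse `w⁻¹` of `w` on `[0,1]`. -/
def wInv {Ω : Type*} [MeasurableSpace Ω] (μ : Measure Ω) (ξ : Ω → ℝ) (s : ℝ) : ℝ :=
  Function.invFunOn (wDist μ ξ) (Set.Icc 0 1) s

/-- Right derivative `δ'₊`. -/
def rtDeriv (f : ℝ → ℝ) (s : ℝ) : ℝ := derivWithin f (Set.Ioi s) s

/-- `δ` is the convex envelope of `ψ` on the set `s`: the largest convex function
on `s` that is pointwise dominated by `ψ` on `s`. -/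
def IsConvexEnvelopeOn (s : Set ℝ) (ψ δ : ℝ → ℝ) : Prop :=
  ConvexOn ℝ s δ ∧ (∀ t ∈ s, δ t ≤ ψ t) ∧
    ∀ g : ℝ → ℝ, ConvexOn ℝ s g → (∀ t ∈ s, g t ≤ ψ t) → ∀ t ∈ s, g t ≤ δ t

/-- The set `𝔾` of quantile functions of nonnegative random variables: nondecreasing on
`[0,1]`, finite and right-continuous on `[0,1)`, left-continuous at `1`. -/
def memG (H : ℝ → ℝ≥0∞) : Prop :=
  MonotoneOn H (Set.Icc 0 1) ∧ (∀ s ∈ Set.Ico (0:ℝ) 1, H s ≠ ⊤) ∧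
    (∀ s ∈ Set.Ico (0:ℝ) 1, ContinuousWithinAt H (Set.Ici s) s) ∧
    ContinuousWithinAt H (Set.Iic 1) 1

/-- Positive part of an extended real, as an `ℝ≥0∞`. -/
def erealPos (a : EReal) : ℝ≥0∞ := if a = ⊤ then ⊤ else ENNReal.ofReal a.toReal

/-- Extended integral of an `EReal`-valued function, valued in `EReal`. -/
def eIntE (ν : Measure ℝ) (f : ℝ → EReal) : EReal :=
  ((∫⁻ z, erealPos (f z) ∂ν : ℝ≥0∞) : EReal)
    - ((∫⁻ z, erealPos (-(f z)) ∂ν : ℝ≥0∞) : EReal)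

/-- The left-continuous version `φ(s−;λ) = (Φ([0, w⁻¹(s))) + λ w⁻¹(s))/(1+λ)`. -/
def phiMinus {Ω : Type*} [MeasurableSpace Ω] (μ : Measure Ω) (ξ : Ω → ℝ)
    (Φ : Measure ℝ) (lam : ℝ) (s : ℝ) : ℝ :=
  ((Φ (Set.Ico 0 (wInv μ ξ s))).toReal + lam * wInv μ ξ s) / (1 + lam)

/-- `H*(s) = (x/E[ξ]) δ'₊(s;λ)`, with the left-limit convention at `s = 1`. -/
def HstarX {Ω : Type*} [MeasurableSpace Ω] (μ : Measure Ω) (ξ : Ω → ℝ) (x : ℝ)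
    (δ : ℝ → ℝ) (s : ℝ) : ℝ≥0∞ :=
  if s = 1 then
    ⨆ t : Set.Ico (0:ℝ) 1, ENNReal.ofReal (x / (∫ ω, ξ ω ∂μ) * rtDeriv δ (t : ℝ))
  else ENNReal.ofReal (x / (∫ ω, ξ ω ∂μ) * rtDeriv δ s)

/-- The objective `J(H) = λ ∫_{[0,1)} ln H(w(u)) du + ∫_{[0,1)} ln H(w(u)) Φ(du)`,
valued in `[-∞, ∞)`, with the convention that the `Φ`-integral is `-∞` whenever
`H(w(s)) = 0` for some `s ∈ [0,1]` with `Φ([0,s]) > 0`. -/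
def Jfun {Ω : Type*} [MeasurableSpace Ω] (μ : Measure Ω) (ξ : Ω → ℝ) (Φ : Measure ℝ)
    (lam : ℝ) (H : ℝ → ℝ≥0∞) : EReal :=
  (lam : EReal) * eIntE (volume.restrict (Set.Ico 0 1))
      (fun u => ENNReal.log (H (wDist μ ξ u)))
    + (if ∃ s ∈ Set.Icc (0:ℝ) 1, H (wDist μ ξ s) = 0 ∧ 0 < Φ (Set.Icc 0 s) then (⊥ : EReal)
       else eIntE (Φ.restrict (Set.Ico 0 1)) (fun u => ENNReal.log (H (wDist μ ξ u))))

section ConvexEnvelope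

variable {δ ψ : ℝ → ℝ}

lemma ConvexOn.monotoneOn_of_nonneg_of_zero (hc : ConvexOn ℝ (Icc 0 1) δ) (h0 : δ 0 = 0)
    (hnn : ∀ t ∈ Icc (0:ℝ) 1, 0 ≤ δ t) : MonotoneOn δ (Icc 0 1) := by
  intro s hs t ht hst
  rcases hs.1.eq_or_lt with rfl | hs0
  · rw [h0]; exact hnn t ht
  rcases hst.eq_or_lt with rfl | hst'
  · exact le_rfl
  have h := hc.secant_mono (a := 0) (x := s) (y := t) (by simp) hs ht hs0.ne'
    (hs0.trans hst').ne' hst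
  rw [h0, sub_zero, sub_zero, sub_zero, sub_zero, div_le_div_iff₀ hs0 (hs0.trans hst')] at h
  have := hnn t ht
  nlinarith [hnn s hs]

lemma ConvexOn.hasDerivWithinAt_rtDeriv (hc : ConvexOn ℝ (Icc 0 1) δ)
    (hm : MonotoneOn δ (Icc 0 1)) {s : ℝ} (hs : s ∈ Ico (0:ℝ) 1) :
    HasDerivWithinAt δ (rtDeriv δ s) (Ioi s) s := by
  have hs' : s ∈ Icc (0:ℝ) 1 := ⟨hs.1, hs.2.le⟩
  have hmem : ∀ t ∈ Ioo s 1, t ∈ Icc (0:ℝ) 1 := fun t ht => ⟨hs.1.trans ht.1.le, ht.2.le⟩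
  have key : ∃ m, Filter.Tendsto (slope δ s) (nhdsWithin s (Ioi s)) (nhds m) := by
    refine ⟨_, MonotoneOn.tendsto_nhdsWithin_Ioo_right (y := 1) (nonempty_Ioo.2 hs.2) ?_ ?_⟩
    · intro t ht u hu htu
      rw [slope_def_field, slope_def_field]
      exact hc.secant_mono hs' (hmem t ht) (hmem u hu) ht.1.ne' hu.1.ne' htu
    · refine ⟨0, ?_⟩
      rintro _ ⟨t, ht, rfl⟩
      rw [slope_def_field]
      exact div_nonneg (sub_nonneg.2 (hm hs' (hmem t ht) ht.1.le)) (sub_nonneg.2 ht.1.le)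
  obtain ⟨m, hmm⟩ := key
  have hd := (hasDerivWithinAt_iff_tendsto_slope' (by simp)).2 hmm
  exact hd.differentiableWithinAt.hasDerivWithinAt

lemma ConvexOn.rtDeriv_mul_le (hc : ConvexOn ℝ (Icc 0 1) δ)
    (hm : MonotoneOn δ (Icc 0 1)) {s t : ℝ} (hs : s ∈ Ico (0:ℝ) 1) (hst : s < t) (ht : t ≤ 1) :
    rtDeriv δ s * (t - s) ≤ δ t - δ s := by
  rw [← le_div_iff₀ (sub_pos.2 hst)]
  refine le_of_tendsto ((hasDerivWithinAt_iff_tendsto_slope' (by simp)).1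
    (hc.hasDerivWithinAt_rtDeriv hm hs)) ?_
  filter_upwards [Ioo_mem_nhdsGT hst] with u hu
  rw [slope_def_field]
  exact hc.secant_mono ⟨hs.1, hs.2.le⟩ ⟨hs.1.trans hu.1.le, hu.2.le.trans ht⟩
    ⟨hs.1.trans hst.le, ht⟩ hu.1.ne' hst.ne' hu.2.le

lemma ConvexOn.le_rtDeriv (hc : ConvexOn ℝ (Icc 0 1) δ)
    (hm : MonotoneOn δ (Icc 0 1)) {s m : ℝ} (hs : s ∈ Ico (0:ℝ) 1)
    (h : ∀ t ∈ Ioo s 1, m * (t - s) ≤ δ t - δ s) : m ≤ rtDeriv δ s := by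
  refine ge_of_tendsto ((hasDerivWithinAt_iff_tendsto_slope' (by simp)).1
    (hc.hasDerivWithinAt_rtDeriv hm hs)) ?_
  filter_upwards [Ioo_mem_nhdsGT hs.2] with u hu
  rw [slope_def_field, le_div_iff₀ (sub_pos.2 hu.1)]
  exact h u hu

lemma ConvexOn.rtDeriv_nonneg (hc : ConvexOn ℝ (Icc 0 1) δ)
    (hm : MonotoneOn δ (Icc 0 1)) {s : ℝ} (hs : s ∈ Ico (0:ℝ) 1) : 0 ≤ rtDeriv δ s :=
  hc.le_rtDeriv hm hs fun t ht => by
    have := hm ⟨hs.1, hs.2.le⟩ ⟨hs.1.trans ht.1.le, ht.2.le⟩ ht.1.le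
    linarith

lemma ConvexOn.monotoneOn_rtDeriv (hc : ConvexOn ℝ (Icc 0 1) δ)
    (hm : MonotoneOn δ (Icc 0 1)) : MonotoneOn (rtDeriv δ) (Ico 0 1) := by
  intro s hs t ht hst
  rcases hst.eq_or_lt with rfl | hst
  · exact le_rfl
  refine hc.le_rtDeriv hm ht fun u hu => ?_
  have h1 : rtDeriv δ s ≤ (δ t - δ s) / (t - s) :=
    (le_div_iff₀ (sub_pos.2 hst)).2 (hc.rtDeriv_mul_le hm hs hst ht.2.le)
  have h2 := hc.slope_mono_adjacent ⟨hs.1, hs.2.le⟩ ⟨ht.1.trans hu.1.le, hu.2.le⟩ hst hu.1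
  exact (le_div_iff₀ (sub_pos.2 hu.1)).1 (h1.trans h2)

/-- Fundamental theorem of calculus for the right derivative of a convex function. -/
lemma ConvexOn.lintegral_rtDeriv (hc : ConvexOn ℝ (Icc 0 1) δ)
    (hm : MonotoneOn δ (Icc 0 1)) (hcont : ContinuousOn δ (Icc 0 1))
    {a b : ℝ} (ha : 0 ≤ a) (hab : a ≤ b) (hb : b ≤ 1) :
    ∫⁻ s in Ico a b, ENNReal.ofReal (rtDeriv δ s) = ENNReal.ofReal (δ b - δ a) := by
  have hsub : Icc a b ⊆ Icc 0 1 := Icc_subset_Icc ha hb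
  have hd : ∀ x ∈ Ioo a b, HasDerivWithinAt δ (rtDeriv δ x) (Ioi x) x := fun x hx =>
    hc.hasDerivWithinAt_rtDeriv hm ⟨ha.trans hx.1.le, hx.2.trans_le hb⟩
  have hn : ∀ x ∈ Ioo a b, 0 ≤ rtDeriv δ x := fun x hx =>
    hc.rtDeriv_nonneg hm ⟨ha.trans hx.1.le, hx.2.trans_le hb⟩
  have hint := intervalIntegral.integrableOn_deriv_right_of_nonneg (hcont.mono hsub) hd hn
  have hint' : IntervalIntegrable (rtDeriv δ) volume a b :=
    (intervalIntegrable_iff_integrableOn_Ioc_of_le hab).2 hint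
  have hftc := intervalIntegral.integral_eq_sub_of_hasDeriv_right (a := a) (b := b)
    (f := δ) (f' := rtDeriv δ) (by rw [uIcc_of_le hab]; exact hcont.mono hsub)
    (by rw [min_eq_left hab, max_eq_right hab]; exact hd) hint'
  rw [intervalIntegral.integral_of_le hab, integral_Ioc_eq_integral_Ioo] at hftc
  rw [setLIntegral_congr (Ioo_ae_eq_Ico (μ := volume)).symm, ← hftc,
    ofReal_integral_eq_lintegral_ofReal (hint.mono_set Ioo_subset_Ioc_self)]
  exact (ae_restrict_iff' measurableSet_Ioo).2 (Filter.Eventually.of_forall hn)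

/-- Every affine function below `ψ` is below its convex envelope. -/
lemma IsConvexEnvelopeOn.affine_le {S : Set ℝ} (hδ : IsConvexEnvelopeOn S ψ δ) {y m : ℝ}
    (h : ∀ t ∈ S, y * t + m ≤ ψ t) : ∀ t ∈ S, y * t + m ≤ δ t := by
  refine hδ.2.2 _ ?_ h
  refine ⟨hδ.1.1, fun u _ v _ p q _ _ hpq => le_of_eq ?_⟩
  simp only [smul_eq_mul]
  linear_combination (-m) * hpq

/-- For each slope `y` some minimizer of `δ - y` is a contact point of the envelope. -/
lemma IsConvexEnvelopeOn.exists_contact (hδ : IsConvexEnvelopeOn (Icc 0 1) ψ δ)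
    (hψ : LowerSemicontinuousOn ψ (Icc 0 1)) (y : ℝ) :
    ∃ b ∈ Icc (0:ℝ) 1, ψ b ≤ δ b ∧ ∀ t ∈ Icc (0:ℝ) 1, δ b + y * (t - b) ≤ δ t := by
  obtain ⟨b, hb, hmin⟩ := LowerSemicontinuousOn.exists_isMinOn (f := fun t => ψ t + -(y * t))
    (nonempty_Icc.2 zero_le_one) isCompact_Icc
    (hψ.add (by
      have : Continuous fun t : ℝ => -(y * t) := by fun_prop
      exact this.lowerSemicontinuous.lowerSemicontinuousOn _))
  have hle := hδ.affine_le (y := y) (m := ψ b - y * b) fun t ht => by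
    have := isMinOn_iff.1 hmin t ht
    linarith
  refine ⟨b, hb, by linarith [hle b hb], fun t ht => ?_⟩
  have := hle t ht
  linarith [hδ.2.1 b hb]

end ConvexEnvelope

section Contact

variable {ν : Measure ℝ} {δ : ℝ → ℝ}

lemma lowerSemicontinuousOn_real_Ico (ν : Measure ℝ) [IsProbabilityMeasure ν] :
    LowerSemicontinuousOn (fun s => ν.real (Ico 0 s)) (Icc 0 1) := by
  intro x _ y hy
  have hmono : Monotone fun n : ℕ => Ico (0:ℝ) (x - 1 / ((n:ℝ) + 1)) := fun m n hmn =>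
    Ico_subset_Ico_right (sub_le_sub_left (Nat.one_div_le_one_div hmn) _)
  have hun : ⋃ n : ℕ, Ico (0:ℝ) (x - 1 / ((n:ℝ) + 1)) = Ico 0 x := by
    ext t
    simp only [mem_iUnion, mem_Ico]
    constructor
    · rintro ⟨n, h0, h1⟩
      exact ⟨h0, h1.trans (sub_lt_self _ Nat.one_div_pos_of_nat)⟩
    · rintro ⟨h0, h1⟩
      obtain ⟨n, hn⟩ := exists_nat_one_div_lt (sub_pos.2 h1)
      exact ⟨n, h0, by linarith⟩
  have ht := tendsto_measure_iUnion_atTop (μ := ν) hmono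
  rw [hun] at ht
  have ht' := (ENNReal.tendsto_toReal (measure_ne_top ν _)).comp ht
  obtain ⟨n, hn⟩ := (ht'.eventually (lt_mem_nhds hy)).exists
  have : Ioi (x - 1 / ((n:ℝ) + 1)) ∈ nhds x :=
    Ioi_mem_nhds (sub_lt_self _ Nat.one_div_pos_of_nat)
  filter_upwards [mem_nhdsWithin_of_mem_nhds this] with u hu
  exact lt_of_lt_of_le hn (measureReal_mono (Ico_subset_Ico_right (le_of_lt hu)))

lemma IsConvexEnvelopeOn.nonneg
    (hδ : IsConvexEnvelopeOn (Icc 0 1) (fun s => ν.real (Ico 0 s)) δ) :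
    ∀ t ∈ Icc (0:ℝ) 1, 0 ≤ δ t := fun t ht => by
  simpa using hδ.affine_le (y := 0) (m := 0) (fun t _ => by simp) t ht

lemma IsConvexEnvelopeOn.zero
    (hδ : IsConvexEnvelopeOn (Icc 0 1) (fun s => ν.real (Ico 0 s)) δ) : δ 0 = 0 :=
  le_antisymm (by simpa using hδ.2.1 0 (by simp)) (hδ.nonneg 0 (by simp))

lemma IsConvexEnvelopeOn.monotoneOn
    (hδ : IsConvexEnvelopeOn (Icc 0 1) (fun s => ν.real (Ico 0 s)) δ) :
    MonotoneOn δ (Icc 0 1) :=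
  hδ.1.monotoneOn_of_nonneg_of_zero hδ.zero hδ.nonneg

lemma IsConvexEnvelopeOn.aemeasurable_rtDeriv
    (hδ : IsConvexEnvelopeOn (Icc 0 1) (fun s => ν.real (Ico 0 s)) δ) (m : Measure ℝ) :
    AEMeasurable (rtDeriv δ) (m.restrict (Ico 0 1)) :=
  aemeasurable_restrict_of_monotoneOn measurableSet_Ico
    (hδ.1.monotoneOn_rtDeriv hδ.monotoneOn)

variable [IsProbabilityMeasure ν]

lemma IsConvexEnvelopeOn.exists_line (hν : ν (Ico 0 1) = 1)
    (hδ : IsConvexEnvelopeOn (Icc 0 1) (fun s => ν.real (Ico 0 s)) δ) {ε : ℝ} (hε : 0 < ε) :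
    ∃ y, ∀ t ∈ Icc (0:ℝ) 1, y * (t - 1) + (1 - ε) ≤ δ t := by
  have h1 := lowerSemicontinuousOn_real_Ico ν 1 (by simp) (1 - min ε 1)
    (by simp [measureReal_def, hν, hε])
  obtain ⟨η, hη, hball⟩ := Metric.mem_nhdsWithin_iff.1 h1
  refine ⟨1 / η, fun t ht => ?_⟩
  have := hδ.affine_le (y := 1 / η) (m := 1 - min ε 1 - 1 / η) (fun u hu => ?_) t ht
  · linarith [min_le_left ε 1]
  have hcalc : 1 / η * u + (1 - min ε 1 - 1 / η) = (1 - min ε 1) - (1 - u) / η := by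
    field_simp
    ring
  rw [hcalc]
  rcases lt_or_ge (1 - u) η with h | h
  · have hu' : u ∈ Metric.ball 1 η ∩ Icc 0 1 := by
      refine ⟨?_, hu⟩
      rw [Metric.mem_ball, Real.dist_eq, abs_sub_comm, abs_of_nonneg (by linarith [hu.2])]
      exact h
    have h2 : 1 - min ε 1 < ν.real (Ico 0 u) := hball hu'
    have : 0 ≤ (1 - u) / η := div_nonneg (by linarith [hu.2]) hη.le
    linarith
  · have : 1 ≤ (1 - u) / η := (one_le_div hη).2 h
    have h3 : 0 < min ε 1 := lt_min hε one_pos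
    have : 0 ≤ ν.real (Ico 0 u) := measureReal_nonneg
    linarith

lemma IsConvexEnvelopeOn.one (hν : ν (Ico 0 1) = 1)
    (hδ : IsConvexEnvelopeOn (Icc 0 1) (fun s => ν.real (Ico 0 s)) δ) : δ 1 = 1 := by
  refine le_antisymm (by simpa [measureReal_def, hν] using hδ.2.1 1 (by simp)) ?_
  refine le_of_forall_sub_le fun ε hε => ?_
  obtain ⟨y, hy⟩ := hδ.exists_line hν hε
  simpa using hy 1 (by simp)

lemma IsConvexEnvelopeOn.le_self (hν : ν (Ico 0 1) = 1)
    (hδ : IsConvexEnvelopeOn (Icc 0 1) (fun s => ν.real (Ico 0 s)) δ) :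
    ∀ t ∈ Icc (0:ℝ) 1, δ t ≤ t := by
  intro t ht
  have := hδ.1.2 (show (0:ℝ) ∈ Icc (0:ℝ) 1 by simp) (show (1:ℝ) ∈ Icc (0:ℝ) 1 by simp)
    (show 0 ≤ 1 - t by linarith [ht.2]) ht.1 (by ring)
  simpa [hδ.zero, hδ.one hν] using this

lemma IsConvexEnvelopeOn.continuousOn (hν : ν (Ico 0 1) = 1)
    (hδ : IsConvexEnvelopeOn (Icc 0 1) (fun s => ν.real (Ico 0 s)) δ) :
    ContinuousOn δ (Icc 0 1) := by
  intro s hs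
  rcases hs.1.eq_or_lt with rfl | h0
  · rw [ContinuousWithinAt, hδ.zero]
    refine tendsto_of_tendsto_of_tendsto_of_le_of_le' tendsto_const_nhds
      (h := fun t => t) (Filter.Tendsto.mono_left Filter.tendsto_id nhdsWithin_le_nhds)
      (eventually_nhdsWithin_of_forall hδ.nonneg)
      (eventually_nhdsWithin_of_forall (hδ.le_self hν))
  rcases hs.2.eq_or_lt with rfl | h1
  · rw [ContinuousWithinAt, hδ.one hν, tendsto_order]
    constructor
    · intro c hc
      obtain ⟨y, hy⟩ := hδ.exists_line hν (ε := (1 - c) / 2) (by linarith)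
      have hcont : Continuous fun t : ℝ => y * (t - 1) + (1 - (1 - c) / 2) := by fun_prop
      have := hcont.continuousWithinAt (s := Icc 0 1) (x := 1)
      filter_upwards [this.eventually (lt_mem_nhds (a := c) (by linarith)), self_mem_nhdsWithin]
        with t ht hts
      exact ht.trans_le (hy t hts)
    · intro c hc
      filter_upwards [self_mem_nhdsWithin] with t ht
      exact ((hδ.le_self hν t ht).trans ht.2).trans_lt hc
  · have := hδ.1.continuousOn_interior
    rw [interior_Icc] at this
    exact (this.continuousAt (Ioo_mem_nhds h0 h1)).continuousWithinAt

/-- The level sets of the right derivative of the envelope are delimited by contact points. -/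
lemma IsConvexEnvelopeOn.exists_contact_level
    (hδ : IsConvexEnvelopeOn (Icc 0 1) (fun s => ν.real (Ico 0 s)) δ) (y : ℝ) :
    ∃ b ∈ Icc (0:ℝ) 1, ν.real (Ico 0 b) = δ b ∧ δ b ≤ y * b ∧
      (∀ s ∈ Ico (0:ℝ) b, rtDeriv δ s ≤ y) ∧ ∀ s ∈ Ico b 1, y ≤ rtDeriv δ s := by
  obtain ⟨b, hb, hcon, hmin⟩ := hδ.exists_contact (lowerSemicontinuousOn_real_Ico ν) y
  have hm := hδ.monotoneOn
  refine ⟨b, hb, le_antisymm hcon (hδ.2.1 b hb), ?_, fun s hs => ?_, fun s hs => ?_⟩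
  · have := hmin 0 (by simp)
    rw [hδ.zero] at this
    linarith
  · have h1 := hδ.1.rtDeriv_mul_le hm ⟨hs.1, hs.2.trans_le hb.2⟩ hs.2 hb.2
    have h2 := hmin s ⟨hs.1, hs.2.le.trans hb.2⟩
    exact le_of_mul_le_mul_right (h1.trans (by linarith)) (sub_pos.2 hs.2)
  · have hb' : b ∈ Ico (0:ℝ) 1 := ⟨hb.1, hs.1.trans_lt hs.2⟩
    refine le_trans ?_ (hδ.1.monotoneOn_rtDeriv hm hb' ⟨hb.1.trans hs.1, hs.2⟩ hs.1)
    refine hδ.1.le_rtDeriv hm hb' fun t ht => ?_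
    linarith [hmin t ⟨hb.1.trans ht.1.le, ht.2.le⟩]

lemma IsConvexEnvelopeOn.measure_rtDeriv_nonpos
    (hδ : IsConvexEnvelopeOn (Icc 0 1) (fun s => ν.real (Ico 0 s)) δ) :
    ν {s ∈ Ico (0:ℝ) 1 | rtDeriv δ s ≤ 0} = 0 := by
  refine nonpos_iff_eq_zero.1 (le_of_forall_gt fun c hc => ?_)
  obtain ⟨y, hy0, hyc⟩ := ENNReal.lt_iff_exists_real_btwn.1 hc
  have hy : 0 < y := ENNReal.ofReal_pos.1 hyc.1
  obtain ⟨b, hb, hcon, hle, -, hge⟩ := hδ.exists_contact_level y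
  refine lt_of_le_of_lt ?_ hyc.2
  calc ν {s ∈ Ico (0:ℝ) 1 | rtDeriv δ s ≤ 0} ≤ ν (Ico 0 b) := by
        refine measure_mono fun s hs => ⟨hs.1.1, not_le.1 fun h => ?_⟩
        linarith [hge s ⟨h, hs.1.2⟩, hs.2]
    _ = ENNReal.ofReal (δ b) := by rw [← hcon, ofReal_measureReal]
    _ ≤ ENNReal.ofReal y := ENNReal.ofReal_le_ofReal (hle.trans (by nlinarith [hb.2]))

lemma IsConvexEnvelopeOn.measure_le_of_upper (hν : ν (Ico 0 1) = 1)
    (hδ : IsConvexEnvelopeOn (Icc 0 1) (fun s => ν.real (Ico 0 s)) δ)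
    {b : ℝ} (hb : b ∈ Icc (0:ℝ) 1) (hcon : ν.real (Ico 0 b) = δ b) {U : Set ℝ}
    (hU : U ⊆ Ico 0 b) (hup : ∀ s ∈ U, ∀ t ∈ Ico (0:ℝ) b, s ≤ t → t ∈ U) :
    ν U ≤ ∫⁻ s in U, ENNReal.ofReal (rtDeriv δ s) := by
  rcases U.eq_empty_or_nonempty with rfl | hne
  · simp
  have hbdd : BddBelow U := ⟨0, fun s hs => (hU hs).1⟩
  set a := sInf U with ha
  have ha0 : 0 ≤ a := le_csInf hne fun s hs => (hU hs).1
  obtain ⟨u, hu⟩ := hne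
  have hab : a ≤ b := (csInf_le hbdd hu).trans (hU hu).2.le
  have hIoo : Ioo a b ⊆ U := fun t ht => by
    obtain ⟨v, hv, hvt⟩ := exists_lt_of_csInf_lt ⟨u, hu⟩ ht.1
    exact hup v hv t ⟨ha0.trans ht.1.le, ht.2⟩ hvt.le
  have hval : ν.real (Ico a b) = ν.real (Ico 0 b) - ν.real (Ico 0 a) := by
    have := measureReal_union (μ := ν) (s₁ := Ico 0 a) (s₂ := Ico a b)
      (by
        rw [Set.disjoint_left]
        intro t h1 h2
        exact absurd h1.2 (not_lt.2 h2.1)) measurableSet_Ico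
    rw [Ico_union_Ico_eq_Ico ha0 hab] at this
    linarith
  calc ν U ≤ ν (Ico a b) := measure_mono fun s hs => ⟨csInf_le hbdd hs, (hU hs).2⟩
    _ ≤ ENNReal.ofReal (δ b - δ a) := by
        rw [← ofReal_measureReal]
        refine ENNReal.ofReal_le_ofReal ?_
        have := hδ.2.1 a ⟨ha0, hab.trans hb.2⟩
        simp only at this
        linarith
    _ = ∫⁻ s in Ico a b, ENNReal.ofReal (rtDeriv δ s) :=
        (hδ.1.lintegral_rtDeriv hδ.monotoneOn (hδ.continuousOn hν) ha0 hab hb.2).symm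
    _ = ∫⁻ s in Ioo a b, ENNReal.ofReal (rtDeriv δ s) :=
        setLIntegral_congr (Ioo_ae_eq_Ico (μ := volume)).symm
    _ ≤ ∫⁻ s in U, ENNReal.ofReal (rtDeriv δ s) := lintegral_mono_set hIoo

/-- Up to a contact point, the envelope stochastically dominates `ν`. -/
lemma IsConvexEnvelopeOn.setLIntegral_le (hν : ν (Ico 0 1) = 1)
    (hδ : IsConvexEnvelopeOn (Icc 0 1) (fun s => ν.real (Ico 0 s)) δ)
    {b : ℝ} (hb : b ∈ Icc (0:ℝ) 1) (hcon : ν.real (Ico 0 b) = δ b) {K : ℝ → ℝ}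
    (hK : MonotoneOn K (Ico 0 1)) (hK0 : ∀ s ∈ Ico (0:ℝ) 1, 0 ≤ K s) :
    ∫⁻ s in Ico 0 b, ENNReal.ofReal (K s) ∂ν ≤
      ∫⁻ s in Ico 0 b, ENNReal.ofReal (rtDeriv δ s) * ENNReal.ofReal (K s) := by
  have hsub : Ico 0 b ⊆ Ico (0:ℝ) 1 := Ico_subset_Ico_right hb.2
  have hnn : ∀ m : Measure ℝ, 0 ≤ᵐ[m.restrict (Ico 0 b)] K := fun m =>
    (ae_restrict_iff' measurableSet_Ico).2 (Filter.Eventually.of_forall fun s hs => hK0 s (hsub hs))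
  have hKm : ∀ m : Measure ℝ, AEMeasurable K (m.restrict (Ico 0 b)) := fun m =>
    aemeasurable_restrict_of_monotoneOn measurableSet_Ico (hK.mono hsub)
  have hh : AEMeasurable (fun s => ENNReal.ofReal (rtDeriv δ s))
      ((volume : Measure ℝ).restrict (Ico 0 b)) :=
    ((hδ.aemeasurable_rtDeriv volume).mono_measure
      (Measure.restrict_mono hsub le_rfl)).ennreal_ofReal
  have hac := withDensity_absolutelyContinuous ((volume : Measure ℝ).restrict (Ico 0 b))
    (fun s => ENNReal.ofReal (rtDeriv δ s))
  have hrhs := lintegral_withDensity_eq_lintegral_mul₀ hh (hKm volume).ennreal_ofReal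
  simp only [Pi.mul_apply] at hrhs
  rw [← hrhs, lintegral_eq_lintegral_meas_lt _ (hnn ν) (hKm ν),
    lintegral_eq_lintegral_meas_lt _ (hac.ae_le (hnn volume)) ((hKm volume).mono_ac hac)]
  refine lintegral_mono fun t => ?_
  have hup : ∀ s ∈ {a | t < K a} ∩ Ico 0 b, ∀ u ∈ Ico (0:ℝ) b, s ≤ u →
      u ∈ {a | t < K a} ∩ Ico 0 b := fun s hs u hu hsu =>
    ⟨lt_of_lt_of_le hs.1 (hK (hsub hs.2) (hsub hu) hsu), hu⟩
  have hmeas : MeasurableSet ({a | t < K a} ∩ Ico 0 b) := by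
    refine OrdConnected.measurableSet ⟨fun p hp q hq u hu => ?_⟩
    exact hup p hp u ⟨hp.2.1.trans hu.1, hu.2.trans_lt hq.2.2⟩ hu.1
  rw [Measure.restrict_apply' measurableSet_Ico]
  refine (hδ.measure_le_of_upper hν hb hcon inter_subset_right hup).trans ?_
  refine le_trans (le_of_eq ?_) (measure_mono (inter_subset_left (t := Ico 0 b)))
  rw [withDensity_apply _ hmeas, Measure.restrict_restrict hmeas, inter_assoc, inter_self]

/-- The first-order optimality inequality for the envelope density. -/
lemma IsConvexEnvelopeOn.lintegral_div_rtDeriv_le (hν : ν (Ico 0 1) = 1)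
    (hδ : IsConvexEnvelopeOn (Icc 0 1) (fun s => ν.real (Ico 0 s)) δ) {H : ℝ → ℝ≥0∞}
    (hH : MonotoneOn H (Ico 0 1)) (hfin : ∀ s ∈ Ico (0:ℝ) 1, H s ≠ ⊤) :
    ∫⁻ s in Ico 0 1, H s / ENNReal.ofReal (rtDeriv δ s) ∂ν ≤ ∫⁻ s in Ico (0:ℝ) 1, H s := by
  set h : ℝ → ℝ≥0∞ := fun s => ENNReal.ofReal (rtDeriv δ s) with hdef
  have hnn : ∀ s ∈ Ico (0:ℝ) 1, 0 ≤ rtDeriv δ s := fun s hs =>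
    hδ.1.rtDeriv_nonneg hδ.monotoneOn hs
  have hHm : ∀ m : Measure ℝ, AEMeasurable H (m.restrict (Ico 0 1)) := fun m =>
    aemeasurable_restrict_of_monotoneOn measurableSet_Ico hH
  have hrm : ∀ m : Measure ℝ, AEMeasurable (fun s => (rtDeriv δ s)⁻¹) (m.restrict (Ico 0 1)) :=
    fun m => (hδ.aemeasurable_rtDeriv m).inv
  have hpos : ∀ᵐ s ∂ν.restrict (Ico 0 1), 0 < rtDeriv δ s := by
    rw [ae_restrict_iff' measurableSet_Ico, ae_iff]
    convert hδ.measure_rtDeriv_nonpos using 2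
    ext s
    simp [and_assoc]
  set m₁ := (ν.restrict (Ico 0 1)).withDensity H with hm₁
  set m₂ := (volume.restrict (Ico 0 1)).withDensity (fun s => h s * H s) with hm₂
  have hhm : AEMeasurable (fun s => h s * H s) (volume.restrict (Ico (0:ℝ) 1)) :=
    (hδ.aemeasurable_rtDeriv volume).ennreal_ofReal.mul (hHm volume)
  have hac₁ : m₁ ≪ ν.restrict (Ico 0 1) := withDensity_absolutelyContinuous _ _
  have hac₂ : m₂ ≪ volume.restrict (Ico 0 1) := withDensity_absolutelyContinuous _ _
  have hmem : ∀ m : Measure ℝ, ∀ᵐ s ∂m.restrict (Ico (0:ℝ) 1), s ∈ Ico (0:ℝ) 1 := fun m =>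
    ae_restrict_mem measurableSet_Ico
  have hinv0 : ∀ m : Measure ℝ, 0 ≤ᵐ[m.restrict (Ico (0:ℝ) 1)] fun s => (rtDeriv δ s)⁻¹ :=
    fun m => (hmem m).mono fun s hs => inv_nonneg.2 (hnn s hs)
  have hpos₂ : ∀ᵐ s ∂m₂, 0 < rtDeriv δ s := by
    rw [hm₂, ae_withDensity_iff' hhm]
    refine Filter.Eventually.of_forall fun s hs => ?_
    exact ENNReal.ofReal_pos.1 (pos_iff_ne_zero.2 (left_ne_zero_of_mul hs))
  have hlevel : ∀ t ∈ Ioi (0:ℝ), m₁ {s | t < (rtDeriv δ s)⁻¹} ≤ m₂ {s | t ≤ (rtDeriv δ s)⁻¹} := by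
    intro t ht
    obtain ⟨b, hb, hcon, -, hlt, hge⟩ := hδ.exists_contact_level t⁻¹
    have hsub : Ico 0 b ⊆ Ico (0:ℝ) 1 := Ico_subset_Ico_right hb.2
    calc m₁ {s | t < (rtDeriv δ s)⁻¹} ≤ m₁ (Ico 0 b) := by
          refine measure_mono_ae ?_
          filter_upwards [hac₁.ae_le (hmem ν), hac₁.ae_le hpos] with s hs hsp hts
          refine ⟨hs.1, not_le.1 fun hbs => ?_⟩
          have h1 : rtDeriv δ s < t⁻¹ := (lt_inv_comm₀ ht hsp).1 hts
          exact absurd (hge s ⟨hbs, hs.2⟩) (not_le.2 h1)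
      _ = ∫⁻ s in Ico 0 b, ENNReal.ofReal (H s).toReal ∂ν := by
          rw [hm₁, withDensity_apply _ measurableSet_Ico, Measure.restrict_restrict_of_subset hsub]
          refine setLIntegral_congr_fun measurableSet_Ico fun s hs => ?_
          exact (ENNReal.ofReal_toReal (hfin s (hsub hs))).symm
      _ ≤ ∫⁻ s in Ico 0 b, h s * ENNReal.ofReal (H s).toReal := by
          refine hδ.setLIntegral_le hν hb hcon (fun s hs u hu hsu => ?_)
            fun _ _ => ENNReal.toReal_nonneg
          exact ENNReal.toReal_mono (hfin u hu) (hH hs hu hsu)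
      _ = m₂ (Ico 0 b) := by
          rw [hm₂, withDensity_apply _ measurableSet_Ico, Measure.restrict_restrict_of_subset hsub]
          refine setLIntegral_congr_fun measurableSet_Ico fun s hs => ?_
          simp only [ENNReal.ofReal_toReal (hfin s (hsub hs))]
      _ ≤ m₂ {s | t ≤ (rtDeriv δ s)⁻¹} := by
          refine measure_mono_ae ?_
          filter_upwards [hpos₂] with s hsp hs
          exact (le_inv_comm₀ ht hsp).2 (hlt s hs)
  calc ∫⁻ s in Ico 0 1, H s / h s ∂ν
      = ∫⁻ s in Ico 0 1, (H * fun s => ENNReal.ofReal (rtDeriv δ s)⁻¹) s ∂ν := by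
        refine lintegral_congr_ae (hpos.mono fun s hs => ?_)
        simp only [Pi.mul_apply, hdef, ENNReal.ofReal_inv_of_pos hs, div_eq_mul_inv]
    _ = ∫⁻ s, ENNReal.ofReal (rtDeriv δ s)⁻¹ ∂m₁ :=
        (lintegral_withDensity_eq_lintegral_mul₀ (hHm ν) (hrm ν).ennreal_ofReal).symm
    _ = ∫⁻ t in Ioi 0, m₁ {s | t < (rtDeriv δ s)⁻¹} :=
        lintegral_eq_lintegral_meas_lt _ (hac₁.ae_le (hinv0 ν)) ((hrm ν).mono_ac hac₁)
    _ ≤ ∫⁻ t in Ioi 0, m₂ {s | t ≤ (rtDeriv δ s)⁻¹} := setLIntegral_mono' measurableSet_Ioi hlevel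
    _ = ∫⁻ s, ENNReal.ofReal (rtDeriv δ s)⁻¹ ∂m₂ :=
        (lintegral_eq_lintegral_meas_le _ (hac₂.ae_le (hinv0 volume))
          ((hrm volume).mono_ac hac₂)).symm
    _ = ∫⁻ s in Ico 0 1, ((fun s => h s * H s) * fun s => ENNReal.ofReal (rtDeriv δ s)⁻¹) s :=
        lintegral_withDensity_eq_lintegral_mul₀ hhm (hrm volume).ennreal_ofReal
    _ ≤ ∫⁻ s in Ico (0:ℝ) 1, H s := by
        refine setLIntegral_mono_ae' measurableSet_Ico (Filter.Eventually.of_forall fun s hs => ?_)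
        simp only [Pi.mul_apply, hdef]
        rcases (hnn s hs).eq_or_lt with h0 | h0
        · simp [← h0]
        · rw [ENNReal.ofReal_inv_of_pos h0, mul_assoc, mul_comm, mul_assoc,
            ENNReal.inv_mul_cancel (ENNReal.ofReal_pos.2 h0).ne' ENNReal.ofReal_ne_top, mul_one]

end Contact

section Quantile

variable {Ω : Type*} [MeasurableSpace Ω] {μ : Measure Ω} {ξ : Ω → ℝ}

lemma wDist_zero : wDist μ ξ 0 = 0 := by simp [wDist]

variable [IsProbabilityMeasure μ]

lemma toReal_measure_le_eq_cdf (hξm : Measurable ξ) (y : ℝ) :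
    (μ {ω | ξ ω ≤ y}).toReal = cdf (μ.map ξ) y := by
  have := Measure.isProbabilityMeasure_map (μ := μ) hξm.aemeasurable
  rw [cdf_eq_real, measureReal_def, Measure.map_apply hξm measurableSet_Iic]
  rfl

lemma qf_set_nonempty (hξm : Measurable ξ) {z : ℝ} (hz : z < 1) :
    {y : ℝ | z < (μ {ω | ξ ω ≤ y}).toReal}.Nonempty := by
  simp only [toReal_measure_le_eq_cdf hξm]
  exact ((tendsto_cdf_atTop (μ.map ξ)).eventually (lt_mem_nhds hz)).exists

lemma exists_pos_lower_bound_qf_set (hξm : Measurable ξ) (hξpos : ∀ ω, 0 < ξ ω)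
    {z : ℝ} (hz : 0 < z) :
    ∃ y₀ > 0, y₀ ∈ lowerBounds {y : ℝ | z < (μ {ω | ξ ω ≤ y}).toReal} := by
  have h0 : cdf (μ.map ξ) 0 < z := by
    rw [← toReal_measure_le_eq_cdf hξm]
    convert hz
    have : {ω | ξ ω ≤ 0} = ∅ := by
      ext ω
      simpa using hξpos ω
    simp [this]
  have hc := ((cdf (μ.map ξ)).right_continuous 0).mono Ioi_subset_Ici_self
  obtain ⟨y₀, hy, hy0⟩ :=
    ((hc.eventually (gt_mem_nhds h0)).and self_mem_nhdsWithin).exists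
  refine ⟨y₀, hy0, fun y hyz => le_of_lt ?_⟩
  simp only [toReal_measure_le_eq_cdf hξm] at hyz
  exact (monotone_cdf (μ.map ξ)).reflect_lt (hy.trans hyz)

lemma qf_pos (hξm : Measurable ξ) (hξpos : ∀ ω, 0 < ξ ω) {z : ℝ} (hz : z ∈ Ioo (0:ℝ) 1) :
    0 < qf μ ξ z := by
  obtain ⟨y₀, hy0, hlb⟩ := exists_pos_lower_bound_qf_set (μ := μ) hξm hξpos hz.1
  exact hy0.trans_le (le_csInf (qf_set_nonempty hξm hz.2) hlb)

lemma monotoneOn_qf (hξm : Measurable ξ) (hξpos : ∀ ω, 0 < ξ ω) :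
    MonotoneOn (qf μ ξ) (Ioo 0 1) := by
  intro a ha b hb hab
  obtain ⟨y₀, -, hlb⟩ := exists_pos_lower_bound_qf_set (μ := μ) hξm hξpos ha.1
  exact csInf_le_csInf ⟨y₀, hlb⟩ (qf_set_nonempty hξm hb.2) fun y hy =>
    lt_of_le_of_lt hab hy

/-- The quantile function, seen as a random variable on `(0,1)`, has the mean of `ξ`. -/
lemma lintegral_qf (hξm : Measurable ξ) (hξpos : ∀ ω, 0 < ξ ω) :
    ∫⁻ z in Ioo (0:ℝ) 1, ENNReal.ofReal (qf μ ξ z) = ∫⁻ ω, ENNReal.ofReal (ξ ω) ∂μ := by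
  have hm : AEMeasurable (qf μ ξ) (volume.restrict (Ioo 0 1)) :=
    aemeasurable_restrict_of_monotoneOn measurableSet_Ioo (monotoneOn_qf hξm hξpos)
  have hnn : 0 ≤ᵐ[volume.restrict (Ioo 0 1)] qf μ ξ :=
    (ae_restrict_iff' measurableSet_Ioo).2
      (Filter.Eventually.of_forall fun z hz => (qf_pos hξm hξpos hz).le)
  have hξnn : 0 ≤ᵐ[μ] ξ := Filter.Eventually.of_forall fun ω => (hξpos ω).le
  have hcompl : ∀ S : Set Ω, MeasurableSet S → μ Sᶜ = ENNReal.ofReal (1 - (μ S).toReal) := by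
    intro S hS
    rw [prob_compl_eq_one_sub hS, ENNReal.ofReal_sub _ ENNReal.toReal_nonneg,
      ENNReal.ofReal_one, ENNReal.ofReal_toReal (measure_ne_top μ S)]
  apply le_antisymm
  · rw [lintegral_eq_lintegral_meas_lt _ hnn hm,
      lintegral_eq_lintegral_meas_lt _ hξnn hξm.aemeasurable]
    refine lintegral_mono fun t => ?_
    have hset : {ω | t < ξ ω} = {ω | ξ ω ≤ t}ᶜ := by
      ext ω
      simp
    rw [hset, hcompl _ (measurableSet_le hξm measurable_const), ← Real.volume_Ico,
      Measure.restrict_apply' measurableSet_Ioo]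
    refine measure_mono fun z hz => ⟨not_lt.1 fun hlt => ?_, hz.2.2⟩
    obtain ⟨y₀, -, hlb⟩ := exists_pos_lower_bound_qf_set (μ := μ) hξm hξpos hz.2.1
    exact absurd (csInf_le ⟨y₀, hlb⟩ hlt) (not_le.2 hz.1)
  · rw [lintegral_eq_lintegral_meas_le _ hnn hm,
      lintegral_eq_lintegral_meas_le _ hξnn hξm.aemeasurable]
    refine lintegral_mono fun t => ?_
    have hset : {ω | t ≤ ξ ω} = {ω | ξ ω < t}ᶜ := by
      ext ω
      simp
    rw [hset, hcompl _ (measurableSet_lt hξm measurable_const), ← Real.volume_Ioo,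
      Measure.restrict_apply' measurableSet_Ioo]
    refine measure_mono fun z hz => ?_
    have hz' : z ∈ Ioo (0:ℝ) 1 := ⟨ENNReal.toReal_nonneg.trans_lt hz.1, hz.2⟩
    refine ⟨(not_lt.1 fun hlt => ?_ : t ≤ qf μ ξ z), hz'⟩
    obtain ⟨y, hy, hyt⟩ := exists_lt_of_csInf_lt (qf_set_nonempty hξm hz.2) hlt
    have : (μ {ω | ξ ω ≤ y}).toReal ≤ (μ {ω | ξ ω < t}).toReal :=
      ENNReal.toReal_mono (measure_ne_top _ _) (measure_mono fun ω hω => lt_of_le_of_lt hω hyt)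
    exact absurd (lt_of_lt_of_le hy this) (not_lt.2 hz.1.le)

lemma integrableOn_qf (hξm : Measurable ξ) (hξpos : ∀ ω, 0 < ξ ω) (hξint : Integrable ξ μ) :
    IntegrableOn (qf μ ξ) (Ioo 0 1) := by
  refine ⟨(aemeasurable_restrict_of_monotoneOn measurableSet_Ioo
    (monotoneOn_qf hξm hξpos)).aestronglyMeasurable, ?_⟩
  rw [hasFiniteIntegral_iff_ofReal ((ae_restrict_iff' measurableSet_Ioo).2
      (Filter.Eventually.of_forall fun z hz => (qf_pos hξm hξpos hz).le)),
    lintegral_qf hξm hξpos, ← hasFiniteIntegral_iff_ofReal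
      (Filter.Eventually.of_forall fun ω => (hξpos ω).le)]
  exact hξint.2

lemma intervalIntegrable_qf_one_sub (hξm : Measurable ξ) (hξpos : ∀ ω, 0 < ξ ω)
    (hξint : Integrable ξ μ) :
    IntervalIntegrable (fun z => qf μ ξ (1 - z)) volume 0 1 := by
  have h : IntervalIntegrable (qf μ ξ) volume 0 1 :=
    (intervalIntegrable_iff_integrableOn_Ioo_of_le zero_le_one).2
      (integrableOn_qf hξm hξpos hξint)
  simpa using (h.comp_sub_left 1).symm

lemma integral_pos_of_forall_pos (hξpos : ∀ ω, 0 < ξ ω) (hξint : Integrable ξ μ) :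
    0 < ∫ ω, ξ ω ∂μ := by
  rw [integral_pos_iff_support_of_nonneg (fun ω => (hξpos ω).le) hξint]
  have : Function.support ξ = univ := by
    ext ω
    simpa using (hξpos ω).ne'
  simp [this]

lemma wDist_one (hξm : Measurable ξ) (hξpos : ∀ ω, 0 < ξ ω) (hξint : Integrable ξ μ) :
    wDist μ ξ 1 = 1 := by
  have hE := integral_pos_of_forall_pos hξpos hξint
  have h1 : ∫ z in (0:ℝ)..1, qf μ ξ (1 - z) = ∫ ω, ξ ω ∂μ := by
    rw [intervalIntegral.integral_comp_sub_left (fun z => qf μ ξ z) 1, sub_self, sub_zero,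
      intervalIntegral.integral_of_le zero_le_one, integral_Ioc_eq_integral_Ioo,
      integral_eq_lintegral_of_nonneg_ae ((ae_restrict_iff' measurableSet_Ioo).2
        (Filter.Eventually.of_forall fun z hz => (qf_pos hξm hξpos hz).le))
        (integrableOn_qf hξm hξpos hξint).1,
      integral_eq_lintegral_of_nonneg_ae
        (Filter.Eventually.of_forall fun ω => (hξpos ω).le) hξint.1, lintegral_qf hξm hξpos]
  rw [wDist, h1, div_self hE.ne']

lemma strictMonoOn_wDist (hξm : Measurable ξ) (hξpos : ∀ ω, 0 < ξ ω) (hξint : Integrable ξ μ) :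
    StrictMonoOn (wDist μ ξ) (Icc 0 1) := by
  intro a ha b hb hab
  have hI := intervalIntegrable_qf_one_sub hξm hξpos hξint
  have hsub : ∀ c ∈ Icc (0:ℝ) 1, ∀ d ∈ Icc (0:ℝ) 1,
      IntervalIntegrable (fun z => qf μ ξ (1 - z)) volume c d := fun c hc d hd =>
    hI.mono_set (by rw [uIcc_of_le (zero_le_one' ℝ)]; exact uIcc_subset_Icc hc hd)
  have hpos : 0 < ∫ z in a..b, qf μ ξ (1 - z) :=
    intervalIntegral.intervalIntegral_pos_of_pos_on (hsub a ha b hb)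
      (fun z hz => qf_pos hξm hξpos ⟨by linarith [hz.2, hb.2], by linarith [hz.1, ha.1]⟩) hab
  have hadd := intervalIntegral.integral_add_adjacent_intervals
    (hsub 0 (by simp) a ha) (hsub a ha b hb)
  exact div_lt_div_of_pos_right (by linarith) (integral_pos_of_forall_pos hξpos hξint)

lemma continuousOn_wDist (hξm : Measurable ξ) (hξpos : ∀ ω, 0 < ξ ω) (hξint : Integrable ξ μ) :
    ContinuousOn (wDist μ ξ) (Icc 0 1) := by
  have hI := intervalIntegrable_qf_one_sub hξm hξpos hξint
  rw [intervalIntegrable_iff_integrableOn_Icc_of_le zero_le_one] at hI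
  have := intervalIntegral.continuousOn_primitive_interval (μ := volume) (a := 0) (b := 1)
    (f := fun z => qf μ ξ (1 - z)) (by rwa [uIcc_of_le (zero_le_one' ℝ)])
  rw [uIcc_of_le (zero_le_one' ℝ)] at this
  exact this.div_const _

lemma wInv_spec (hξm : Measurable ξ) (hξpos : ∀ ω, 0 < ξ ω) (hξint : Integrable ξ μ)
    {s : ℝ} (hs : s ∈ Icc (0:ℝ) 1) : wInv μ ξ s ∈ Icc (0:ℝ) 1 ∧ wDist μ ξ (wInv μ ξ s) = s := by
  have h : ∃ a ∈ Icc (0:ℝ) 1, wDist μ ξ a = s := by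
    have := intermediate_value_Icc zero_le_one (continuousOn_wDist hξm hξpos hξint)
    rw [wDist_zero, wDist_one hξm hξpos hξint] at this
    exact this hs
  exact ⟨Function.invFunOn_mem h, Function.invFunOn_eq h⟩

end Quantile

section LogIntegral

lemma measurable_erealPos : Measurable erealPos := by
  refine Measurable.ite (measurableSet_singleton _) measurable_const ?_
  exact ENNReal.measurable_ofReal.comp measurable_ereal_toReal

/-- Pointwise form of `log a ≤ log b + a / b - 1`, split into positive and negative parts. -/
lemma erealPos_log_add_le {a b : ℝ≥0∞} (ha : a ≠ ⊤) (hb0 : b ≠ 0) (hb : b ≠ ⊤) :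
    erealPos (ENNReal.log a) + erealPos (-ENNReal.log b) + 1 ≤
      erealPos (-ENNReal.log a) + erealPos (ENNReal.log b) + a / b := by
  rcases eq_or_ne a 0 with rfl | ha0
  · simp [erealPos]
  lift a to ℝ≥0 using ha
  lift b to ℝ≥0 using hb
  have ha' : 0 < (a:ℝ) := by
    have : a ≠ 0 := by simpa using ha0
    positivity
  have hb' : 0 < (b:ℝ) := by
    have : b ≠ 0 := by simpa using hb0
    positivity
  have hdiv : (a:ℝ≥0∞) / b = ENNReal.ofReal ((a:ℝ) / b) := by
    rw [ENNReal.ofReal_div_of_pos hb']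
    simp
  have hne : ∀ u : ℝ, erealPos (u : EReal) = ENNReal.ofReal u := fun u => by
    simp [erealPos]
  rw [ENNReal.log_pos_real ha0 ENNReal.coe_ne_top, ENNReal.log_pos_real hb0 ENNReal.coe_ne_top,
    ← EReal.coe_neg, ← EReal.coe_neg, hne, hne, hne, hne, hdiv, ENNReal.coe_toReal,
    ENNReal.coe_toReal]
  have hlog : Real.log a - Real.log b ≤ a / b - 1 := by
    rw [← Real.log_div ha'.ne' hb'.ne']
    exact Real.log_le_sub_one_of_pos (div_pos ha' hb')
  simp only [ENNReal.ofReal]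
  norm_cast
  rw [← NNReal.coe_le_coe]
  push_cast
  simp only [Real.coe_toNNReal', max_eq_left (div_pos ha' hb').le]
  have h1 : ∀ u : ℝ, max u 0 - max (-u) 0 = u := fun u => by
    rcases le_total 0 u with h | h
    · simp [h]
    · simp [h]
  linarith [h1 (Real.log a), h1 (Real.log b)]

lemma erealPos_neg_log_le_inv {b : ℝ≥0∞} (hb : b ≠ ⊤) :
    erealPos (-ENNReal.log b) ≤ b⁻¹ := by
  rcases eq_or_ne b 0 with rfl | hb0
  · simp
  lift b to ℝ≥0 using hb
  have hb' : 0 < (b:ℝ) := by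
    have : b ≠ 0 := by simpa using hb0
    positivity
  rw [ENNReal.log_pos_real hb0 ENNReal.coe_ne_top, ← EReal.coe_neg, ENNReal.coe_toReal, erealPos,
    if_neg (EReal.coe_ne_top _), EReal.toReal_coe, ← ENNReal.ofReal_coe_nnreal,
    ← ENNReal.ofReal_inv_of_pos hb', ← Real.log_inv]
  exact ENNReal.ofReal_le_ofReal
    ((Real.log_le_sub_one_of_pos (inv_pos.2 hb')).trans (sub_le_self _ zero_le_one))

variable {m : Measure ℝ} {f g : ℝ → ℝ≥0∞}

lemma lintegral_erealPos_neg_log_ne_top (hg : ∀ᵐ u ∂m, g u ≠ ⊤) (hinv : ∫⁻ u, (g u)⁻¹ ∂m ≠ ⊤) :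
    ∫⁻ u, erealPos (-ENNReal.log (g u)) ∂m ≠ ⊤ :=
  ne_top_of_le_ne_top hinv (lintegral_mono_ae (hg.mono fun _ h => erealPos_neg_log_le_inv h))

/-- Integrated form of `log f ≤ log g + f / g - 1`. -/
lemma lintegral_erealPos_log_add_le [IsProbabilityMeasure m] (hfm : AEMeasurable f m)
    (hgm : AEMeasurable g m) (hf : ∀ᵐ u ∂m, f u ≠ ⊤) (hg : ∀ᵐ u ∂m, g u ≠ ⊤)
    (hinv : ∫⁻ u, (g u)⁻¹ ∂m ≠ ⊤) :
    ∫⁻ u, erealPos (ENNReal.log (f u)) ∂m + ∫⁻ u, erealPos (-ENNReal.log (g u)) ∂m + 1 ≤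
      ∫⁻ u, erealPos (-ENNReal.log (f u)) ∂m + ∫⁻ u, erealPos (ENNReal.log (g u)) ∂m
        + ∫⁻ u, f u / g u ∂m := by
  have hpos : ∀ᵐ u ∂m, g u ≠ 0 := by
    filter_upwards [ae_lt_top' hgm.inv hinv] with u hu h0
    simp [h0] at hu
  have hP : ∀ {k : ℝ → ℝ≥0∞}, AEMeasurable k m →
      AEMeasurable (fun u => erealPos (ENNReal.log (k u))) m := fun hk =>
    measurable_erealPos.comp_aemeasurable (ENNReal.measurable_log.comp_aemeasurable hk)
  have hN : ∀ {k : ℝ → ℝ≥0∞}, AEMeasurable k m →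
      AEMeasurable (fun u => erealPos (-ENNReal.log (k u))) m := fun hk =>
    measurable_erealPos.comp_aemeasurable
      (measurable_neg.comp_aemeasurable (ENNReal.measurable_log.comp_aemeasurable hk))
  have hdiv : AEMeasurable (fun u => f u / g u) m := hfm.div hgm
  have hone : (1 : ℝ≥0∞) = ∫⁻ _, 1 ∂m := by simp
  rw [hone, ← lintegral_add_left' (hP hfm), ← lintegral_add_right' _ aemeasurable_const,
    ← lintegral_add_left' (hN hfm), ← lintegral_add_right' _ hdiv]
  refine lintegral_mono_ae ?_
  filter_upwards [hpos, hf, hg] with u h1 h2 h3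
  exact erealPos_log_add_le h2 h1 h3

lemma EReal.coe_ennreal_sub_ne_bot {P M : ℝ≥0∞} (hM : M ≠ ⊤) :
    (P : EReal) - (M : EReal) ≠ ⊥ := by
  lift M to ℝ≥0 using hM
  rcases eq_or_ne P ⊤ with rfl | hP
  · simp
  lift P to ℝ≥0 using hP
  simp only [EReal.coe_nnreal_eq_coe_real]
  rw [← EReal.coe_sub]
  exact EReal.coe_ne_bot _

lemma EReal.coe_ennreal_sub_le_of_add_le {p q P M : ℝ≥0∞} (hM : M ≠ ⊤) (h : p + M ≤ q + P) :
    (p : EReal) - (q : EReal) ≤ (P : EReal) - (M : EReal) := by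
  lift M to ℝ≥0 using hM
  rcases eq_or_ne q ⊤ with rfl | hq
  · simp [sub_eq_add_neg]
  rcases eq_or_ne P ⊤ with rfl | hP
  · simp
  lift q to ℝ≥0 using hq
  lift P to ℝ≥0 using hP
  have hp : p ≠ ⊤ := fun hp => by simp [hp] at h
  lift p to ℝ≥0 using hp
  norm_cast at h
  have h' : (p:ℝ) + M ≤ q + P := by exact_mod_cast h
  simp only [EReal.coe_nnreal_eq_coe_real]
  norm_cast
  linarith

/-- Combination of the two first-order inequalities with weights `lam` and `1`. -/
lemma weighted_sub_le_weighted_sub {lam : ℝ} (hlam : 0 ≤ lam)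
    {p₁ q₁ P₁ M₁ k₁ p₂ q₂ P₂ M₂ k₂ : ℝ≥0∞}
    (h₁ : 0 < lam → p₁ + M₁ + 1 ≤ q₁ + P₁ + k₁) (h₂ : p₂ + M₂ + 1 ≤ q₂ + P₂ + k₂)
    (hM₁ : 0 < lam → M₁ ≠ ⊤) (hM₂ : M₂ ≠ ⊤)
    (hk : ENNReal.ofReal lam * k₁ + k₂ ≤ ENNReal.ofReal (1 + lam)) :
    (lam : EReal) * ((p₁ : EReal) - (q₁ : EReal)) + ((p₂ : EReal) - (q₂ : EReal)) ≤
      (lam : EReal) * ((P₁ : EReal) - (M₁ : EReal)) + ((P₂ : EReal) - (M₂ : EReal)) := by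
  rcases hlam.eq_or_lt with rfl | hpos
  · simp only [EReal.coe_zero, zero_mul, zero_add]
    refine EReal.coe_ennreal_sub_le_of_add_le hM₂ ?_
    have hk' : k₂ ≤ 1 := by simpa using hk
    exact (ENNReal.add_le_add_iff_right ENNReal.one_ne_top).1 (h₂.trans (by gcongr))
  specialize h₁ hpos
  specialize hM₁ hpos
  have hktop := ne_top_of_le_ne_top ENNReal.ofReal_ne_top hk
  have hk₂ : k₂ ≠ ⊤ := fun h => hktop (by simp [h])
  have hk₁ : k₁ ≠ ⊤ := fun h => hktop (by
    simp [h, hpos])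
  have hb₁ : (P₁ : EReal) - (M₁ : EReal) ≠ ⊥ := EReal.coe_ennreal_sub_ne_bot hM₁
  have hb₂ : (P₂ : EReal) - (M₂ : EReal) ≠ ⊥ := EReal.coe_ennreal_sub_ne_bot hM₂
  lift M₁ to ℝ≥0 using hM₁
  lift M₂ to ℝ≥0 using hM₂
  lift k₁ to ℝ≥0 using hk₁
  lift k₂ to ℝ≥0 using hk₂
  rcases eq_or_ne q₁ ⊤ with rfl | hq₁
  · simp [sub_eq_add_neg, EReal.coe_mul_bot_of_pos hpos]
  rcases eq_or_ne q₂ ⊤ with rfl | hq₂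
  · simp [sub_eq_add_neg]
  rcases eq_or_ne P₁ ⊤ with rfl | hP₁
  · rw [show ((⊤ : ℝ≥0∞) : EReal) - ((M₁ : ℝ≥0∞) : EReal) = ⊤ by simp,
      EReal.coe_mul_top_of_pos hpos, EReal.top_add_of_ne_bot hb₂]
    exact le_top
  rcases eq_or_ne P₂ ⊤ with rfl | hP₂
  · rw [show ((⊤ : ℝ≥0∞) : EReal) - ((M₂ : ℝ≥0∞) : EReal) = ⊤ by simp,
      EReal.add_top_of_ne_bot]
    · exact le_top
    · lift P₁ to ℝ≥0 using hP₁
      simp only [EReal.coe_nnreal_eq_coe_real]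
      norm_cast
      exact EReal.coe_ne_bot _
  lift q₁ to ℝ≥0 using hq₁
  lift q₂ to ℝ≥0 using hq₂
  lift P₁ to ℝ≥0 using hP₁
  lift P₂ to ℝ≥0 using hP₂
  have hp₁ : p₁ ≠ ⊤ := fun hp => by
    simp only [hp, top_add, top_le_iff] at h₁
    exact absurd h₁ (by finiteness)
  have hp₂ : p₂ ≠ ⊤ := fun hp => by
    simp only [hp, top_add, top_le_iff] at h₂
    exact absurd h₂ (by finiteness)
  lift p₁ to ℝ≥0 using hp₁
  lift p₂ to ℝ≥0 using hp₂
  lift lam to ℝ≥0 using hlam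
  have h₁' : (p₁:ℝ) + M₁ + 1 ≤ q₁ + P₁ + k₁ := by exact_mod_cast h₁
  have h₂' : (p₂:ℝ) + M₂ + 1 ≤ q₂ + P₂ + k₂ := by exact_mod_cast h₂
  have hk' : (lam:ℝ) * k₁ + k₂ ≤ 1 + lam := by
    rw [show (1 + (lam:ℝ)) = ((1 + lam : ℝ≥0) : ℝ) by push_cast; rfl,
      ENNReal.ofReal_coe_nnreal, ENNReal.ofReal_coe_nnreal] at hk
    exact_mod_cast hk
  simp only [EReal.coe_nnreal_eq_coe_real]
  norm_cast
  have := mul_le_mul_of_nonneg_left h₁' lam.2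
  nlinarith

end LogIntegral

section Mixture

variable {Φ : Measure ℝ} {lam : ℝ} {w : ℝ → ℝ}

/-- The normalized image under `w` of `lam • volume + Φ` on `[0,1)`. -/
def mixtureMap (Φ : Measure ℝ) (lam : ℝ) (w : ℝ → ℝ) : Measure ℝ :=
  (ENNReal.ofReal (1 + lam))⁻¹ •
    (ENNReal.ofReal lam • volume.restrict (Ico 0 1) + Φ.restrict (Ico 0 1)).map w

lemma aemeasurable_mixture (hw : MonotoneOn w (Ico 0 1)) :
    AEMeasurable w
      (ENNReal.ofReal lam • volume.restrict (Ico (0:ℝ) 1) + Φ.restrict (Ico 0 1)) :=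
  ((aemeasurable_restrict_of_monotoneOn measurableSet_Ico hw).smul_measure _).add_measure
    (aemeasurable_restrict_of_monotoneOn measurableSet_Ico hw)

lemma lintegral_mixtureMap (hlam : 0 ≤ lam) (hw : MonotoneOn w (Ico 0 1)) {F : ℝ → ℝ≥0∞}
    (hF : AEMeasurable F (mixtureMap Φ lam w)) :
    ENNReal.ofReal lam * (∫⁻ u in Ico 0 1, F (w u)) + ∫⁻ u in Ico 0 1, F (w u) ∂Φ =
      ENNReal.ofReal (1 + lam) * ∫⁻ s, F s ∂mixtureMap Φ lam w := by
  have h0 : ENNReal.ofReal (1 + lam) ≠ 0 := by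
    rw [Ne, ENNReal.ofReal_eq_zero]
    linarith
  have hF' : AEMeasurable F
      ((ENNReal.ofReal lam • volume.restrict (Ico 0 1) + Φ.restrict (Ico 0 1)).map w) :=
    hF.mono_ac (Measure.absolutelyContinuous_smul (ENNReal.inv_ne_zero.2 ENNReal.ofReal_ne_top))
  rw [mixtureMap, lintegral_smul_measure, smul_eq_mul, ← mul_assoc,
    ENNReal.mul_inv_cancel h0 ENNReal.ofReal_ne_top, one_mul,
    lintegral_map' hF' (aemeasurable_mixture hw), lintegral_add_measure,
    lintegral_smul_measure, smul_eq_mul]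

lemma mixtureMap_apply (hw : MonotoneOn w (Ico 0 1)) {A B : ℝ → Prop}
    (hA : MeasurableSet {s | A s}) (hB : MeasurableSet {u | B u})
    (h : ∀ u ∈ Ico (0:ℝ) 1, A (w u) ↔ B u) :
    mixtureMap Φ lam w {s | A s} = (ENNReal.ofReal (1 + lam))⁻¹ *
      (ENNReal.ofReal lam * volume ({u | B u} ∩ Ico 0 1) + Φ ({u | B u} ∩ Ico 0 1)) := by
  have hpre : (ENNReal.ofReal lam • volume.restrict (Ico (0:ℝ) 1) + Φ.restrict (Ico 0 1))
      (w ⁻¹' {s | A s}) =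
      (ENNReal.ofReal lam • volume.restrict (Ico (0:ℝ) 1) + Φ.restrict (Ico 0 1)) {u | B u} := by
    have hae : ∀ m : Measure ℝ, ∀ᵐ u ∂m.restrict (Ico (0:ℝ) 1), A (w u) ↔ B u := fun m =>
      (ae_restrict_iff' measurableSet_Ico).2 (Filter.Eventually.of_forall h)
    refine measure_congr (Filter.eventuallyEq_set.2 ?_)
    rw [ae_add_measure_iff]
    exact ⟨Measure.ae_smul_measure (hae _) _, hae _⟩
  rw [mixtureMap, Measure.smul_apply, smul_eq_mul,
    Measure.map_apply_of_aemeasurable (aemeasurable_mixture hw) hA, hpre, Measure.add_apply,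
    Measure.smul_apply, smul_eq_mul, Measure.restrict_apply hB, Measure.restrict_apply hB]

lemma isProbabilityMeasure_mixtureMap (hlam : 0 ≤ lam) (hw : MonotoneOn w (Ico 0 1))
    (hΦ : Φ (Ico 0 1) = 1) : IsProbabilityMeasure (mixtureMap Φ lam w) := by
  constructor
  have := mixtureMap_apply (Φ := Φ) (lam := lam) hw (A := fun _ => True) (B := fun _ => True)
    (by simp) (by simp) (by simp)
  rw [ofPred_true, univ_inter, hΦ, Real.volume_Ico, sub_zero, ENNReal.ofReal_one, mul_one,
    add_comm (ENNReal.ofReal lam), ← ENNReal.ofReal_one,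
    ← ENNReal.ofReal_add zero_le_one hlam] at this
  rw [this, ENNReal.inv_mul_cancel _ ENNReal.ofReal_ne_top]
  rw [Ne, ENNReal.ofReal_eq_zero]
  linarith

lemma mixtureMap_Ico_zero_one [IsProbabilityMeasure (mixtureMap Φ lam w)]
    (hw : MonotoneOn w (Ico 0 1)) (hmaps : MapsTo w (Ico 0 1) (Ico 0 1)) :
    mixtureMap Φ lam w (Ico 0 1) = 1 := by
  have h₁ := mixtureMap_apply (Φ := Φ) (lam := lam) hw (A := fun _ => True) (B := fun _ => True)
    (by simp) (by simp) (by simp)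
  have h₂ := mixtureMap_apply (Φ := Φ) (lam := lam) hw (A := fun s => s ∈ Ico (0:ℝ) 1)
    (B := fun _ => True) measurableSet_Ico (by simp) (fun u hu => by simpa using hmaps hu)
  rw [← h₁, ofPred_true, measure_univ] at h₂
  exact h₂

lemma mixtureMap_real_Ico [IsProbabilityMeasure Φ] (hlam : 0 ≤ lam)
    (hw : StrictMonoOn w (Icc 0 1)) (hmaps : MapsTo w (Ico 0 1) (Ico 0 1)) {v : ℝ}
    (hv : v ∈ Icc (0:ℝ) 1) :
    (mixtureMap Φ lam w).real (Ico 0 (w v)) = (Φ.real (Ico 0 v) + lam * v) / (1 + lam) := by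
  have h := mixtureMap_apply (Φ := Φ) (lam := lam)
    (hw.monotoneOn.mono Ico_subset_Icc_self) (A := fun s => s ∈ Ico 0 (w v))
    (B := fun u => u ∈ Ico 0 v) measurableSet_Ico measurableSet_Ico fun u hu => by
      simp [(hmaps hu).1, hu.1, hw.lt_iff_lt (Ico_subset_Icc_self hu) hv]
  simp only [ofPred_mem_eq] at h
  rw [inter_eq_self_of_subset_left (Ico_subset_Ico_right hv.2)] at h
  rw [Measure.real, h, ENNReal.toReal_mul, ENNReal.toReal_inv,
    ENNReal.toReal_ofReal (by linarith), ENNReal.toReal_add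
      (ENNReal.mul_ne_top ENNReal.ofReal_ne_top measure_Ico_lt_top.ne) (measure_ne_top _ _),
    ENNReal.toReal_mul, ENNReal.toReal_ofReal hlam, Real.volume_Ico, sub_zero,
    ENNReal.toReal_ofReal hv.1, Measure.real]
  ring

lemma measure_eq_zero_of_mixtureMap_eq_zero (hw : MonotoneOn w (Ico 0 1)) {A : Set ℝ}
    (hA : mixtureMap Φ lam w A = 0) : Φ ({u | w u ∈ A} ∩ Ico 0 1) = 0 := by
  rw [mixtureMap, Measure.smul_apply, smul_eq_mul, mul_eq_zero,
    or_iff_right (ENNReal.inv_ne_zero.2 ENNReal.ofReal_ne_top)] at hA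
  have h := ae_of_ae_map (aemeasurable_mixture hw) (measure_eq_zero_iff_ae_notMem.1 hA)
  rw [ae_add_measure_iff] at h
  have h' := (ae_restrict_iff' measurableSet_Ico).1 h.2
  refine measure_mono_null ?_ (ae_iff.1 h')
  rintro u ⟨hu, hu'⟩
  simp only [mem_ofPred_eq, not_forall, not_not]
  exact ⟨hu', hu⟩

end Mixture

lemma IsConvexEnvelopeOn.congr {S : Set ℝ} {ψ ψ' δ : ℝ → ℝ} (hδ : IsConvexEnvelopeOn S ψ δ)
    (h : ∀ t ∈ S, ψ t = ψ' t) : IsConvexEnvelopeOn S ψ' δ :=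
  ⟨hδ.1, fun t ht => h t ht ▸ hδ.2.1 t ht,
    fun g hg hle => hδ.2.2 g hg fun t ht => (h t ht).symm ▸ hle t ht⟩

section Optimality

variable {Ω : Type*} [MeasurableSpace Ω] {μ : Measure Ω} {ξ : Ω → ℝ} {x lam : ℝ}
  {Φ ν : Measure ℝ} {δ : ℝ → ℝ}

lemma HstarX_of_lt_one {s : ℝ} (hc : 0 ≤ x / ∫ ω, ξ ω ∂μ) (hs : s < 1) :
    HstarX μ ξ x δ s =
      ENNReal.ofReal (x / ∫ ω, ξ ω ∂μ) * ENNReal.ofReal (rtDeriv δ s) := by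
  rw [HstarX, if_neg hs.ne, ENNReal.ofReal_mul hc]

lemma monotoneOn_HstarX (hδ : IsConvexEnvelopeOn (Icc 0 1) (fun s => ν.real (Ico 0 s)) δ)
    (hc : 0 ≤ x / ∫ ω, ξ ω ∂μ) : MonotoneOn (HstarX μ ξ x δ) (Ico 0 1) := by
  intro s hs t ht hst
  rw [HstarX_of_lt_one hc hs.2, HstarX_of_lt_one hc ht.2]
  gcongr
  exact hδ.1.monotoneOn_rtDeriv hδ.monotoneOn hs ht hst

variable [IsProbabilityMeasure ν]

lemma lintegral_rtDeriv_eq_one (hν : ν (Ico 0 1) = 1)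
    (hδ : IsConvexEnvelopeOn (Icc 0 1) (fun s => ν.real (Ico 0 s)) δ) :
    ∫⁻ s in Ico (0:ℝ) 1, ENNReal.ofReal (rtDeriv δ s) = 1 := by
  rw [hδ.1.lintegral_rtDeriv hδ.monotoneOn (hδ.continuousOn hν) le_rfl zero_le_one le_rfl,
    hδ.one hν, hδ.zero, sub_zero, ENNReal.ofReal_one]

lemma lintegral_HstarX (hν : ν (Ico 0 1) = 1)
    (hδ : IsConvexEnvelopeOn (Icc 0 1) (fun s => ν.real (Ico 0 s)) δ)
    (hc : 0 ≤ x / ∫ ω, ξ ω ∂μ) :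
    ∫⁻ s in Ico (0:ℝ) 1, HstarX μ ξ x δ s = ENNReal.ofReal (x / ∫ ω, ξ ω ∂μ) := by
  rw [setLIntegral_congr_fun measurableSet_Ico fun s hs => HstarX_of_lt_one hc hs.2,
    lintegral_const_mul' _ _ ENNReal.ofReal_ne_top, lintegral_rtDeriv_eq_one hν hδ, mul_one]

lemma lintegral_div_HstarX_le (hν : ν (Ico 0 1) = 1)
    (hδ : IsConvexEnvelopeOn (Icc 0 1) (fun s => ν.real (Ico 0 s)) δ)
    (hc : 0 < x / ∫ ω, ξ ω ∂μ) {H : ℝ → ℝ≥0∞} (hH : MonotoneOn H (Ico 0 1))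
    (hfin : ∀ s ∈ Ico (0:ℝ) 1, H s ≠ ⊤) :
    ∫⁻ s in Ico (0:ℝ) 1, H s / HstarX μ ξ x δ s ∂ν ≤
      (ENNReal.ofReal (x / ∫ ω, ξ ω ∂μ))⁻¹ * ∫⁻ s in Ico (0:ℝ) 1, H s := by
  have hc0 : ENNReal.ofReal (x / ∫ ω, ξ ω ∂μ) ≠ 0 := by simpa using hc
  have h : ∀ s ∈ Ico (0:ℝ) 1, H s / HstarX μ ξ x δ s =
      (ENNReal.ofReal (x / ∫ ω, ξ ω ∂μ))⁻¹ * (H s / ENNReal.ofReal (rtDeriv δ s)) := by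
    intro s hs
    rw [HstarX_of_lt_one hc.le hs.2, ENNReal.div_eq_inv_mul, ENNReal.div_eq_inv_mul,
      ENNReal.mul_inv (.inl hc0) (.inl ENNReal.ofReal_ne_top)]
    rw [mul_assoc]
  rw [setLIntegral_congr_fun measurableSet_Ico h,
    lintegral_const_mul' _ _ (ENNReal.inv_ne_top.2 hc0)]
  exact mul_le_mul_right (hδ.lintegral_div_rtDeriv_le hν hH hfin) _

lemma measure_Icc_of_HstarX_eq_zero (hν : ν (Ico 0 1) = 1)
    (hδ : IsConvexEnvelopeOn (Icc 0 1) (fun s => ν.real (Ico 0 s)) δ)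
    (hc : 0 < x / ∫ ω, ξ ω ∂μ) {t : ℝ} (ht : t ∈ Icc (0:ℝ) 1) (h : HstarX μ ξ x δ t = 0) :
    t < 1 ∧ ν (Icc 0 t) = 0 := by
  have hc0 : ENNReal.ofReal (x / ∫ ω, ξ ω ∂μ) ≠ 0 := by simpa using hc
  have ht1 : t < 1 := by
    refine lt_of_le_of_ne ht.2 ?_
    rintro rfl
    rw [HstarX, if_pos rfl, ENNReal.iSup_eq_zero] at h
    have h0 : ∀ s ∈ Ico (0:ℝ) 1, HstarX μ ξ x δ s = 0 := fun s hs => by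
      rw [HstarX, if_neg hs.2.ne]
      exact h ⟨s, hs⟩
    have hint := lintegral_HstarX hν hδ hc.le
    rw [setLIntegral_congr_fun measurableSet_Ico h0, lintegral_zero] at hint
    exact hc0 hint.symm
  refine ⟨ht1, measure_mono_null ?_ (hδ.measure_rtDeriv_nonpos)⟩
  intro s hs
  have hs' : s ∈ Ico (0:ℝ) 1 := ⟨hs.1, hs.2.trans_lt ht1⟩
  refine ⟨hs', ?_⟩
  rw [HstarX_of_lt_one hc.le ht1, mul_eq_zero, or_iff_right hc0, ENNReal.ofReal_eq_zero] at h
  exact (hδ.1.monotoneOn_rtDeriv hδ.monotoneOn hs' ⟨ht.1, ht1⟩ hs.2).trans h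

end Optimality

/-- `H* = (x/E[ξ]) δ'₊(·;λ)` satisfies the budget constraint
`∫_0^1 H*(s) ds = x/E[ξ]` and maximizes `J` over all `H ∈ 𝔾` satisfying the budget
constraint, where `δ(·;λ)` is the convex envelope of `φ(·−;λ)` on `[0,1]`. -/
theorem constrained_quantile_maximizer
    {Ω : Type*} [MeasurableSpace Ω] (μ : Measure Ω) [IsProbabilityMeasure μ]
    (ξ : Ω → ℝ) (hξm : Measurable ξ) (hξpos : ∀ ω, 0 < ξ ω) (hξint : Integrable ξ μ)
    (T r θ : ℝ) (hT : 0 < T) (hr : 0 < r) (hθ : 0 < θ)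
    (hlog : μ.map (fun ω => Real.log (ξ ω))
      = gaussianReal (-(r + θ ^ 2 / 2) * T) ((θ ^ 2 * T).toNNReal))
    (Φ : Measure ℝ) [IsProbabilityMeasure Φ]
    (hΦsupp : Φ (Set.Icc (0:ℝ) 1)ᶜ = 0) (hΦone : Φ {(1:ℝ)} = 0)
    (hΦnotunif : Φ ≠ volume.restrict (Set.Icc (0:ℝ) 1))
    (lam x : ℝ) (hlam : 0 ≤ lam) (hx : 0 < x)
    (δ : ℝ → ℝ) (hδ : IsConvexEnvelopeOn (Set.Icc 0 1) (phiMinus μ ξ Φ lam) δ) :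
    (∫⁻ s in Set.Ico (0:ℝ) 1, HstarX μ ξ x δ s) = ENNReal.ofReal (x / ∫ ω, ξ ω ∂μ) ∧
      ∀ H : ℝ → ℝ≥0∞, memG H →
        (∫⁻ s in Set.Ico (0:ℝ) 1, H s) = ENNReal.ofReal (x / ∫ ω, ξ ω ∂μ) →
        Jfun μ ξ Φ lam H ≤ Jfun μ ξ Φ lam (HstarX μ ξ x δ) := by
  have hc : 0 < x / ∫ ω, ξ ω ∂μ := div_pos hx (integral_pos_of_forall_pos hξpos hξint)
  have hc0 : ENNReal.ofReal (x / ∫ ω, ξ ω ∂μ) ≠ 0 := by simpa using hc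
  have hw := strictMonoOn_wDist hξm hξpos hξint
  have hw1 := wDist_one hξm hξpos hξint
  have hwm : MonotoneOn (wDist μ ξ) (Ico 0 1) := hw.monotoneOn.mono Ico_subset_Icc_self
  have hmaps : MapsTo (wDist μ ξ) (Ico 0 1) (Ico 0 1) := fun u hu => by
    constructor
    · rw [← wDist_zero (μ := μ) (ξ := ξ)]
      exact hw.monotoneOn (by simp) (Ico_subset_Icc_self hu) hu.1
    · rw [← hw1]
      exact hw (Ico_subset_Icc_self hu) (by simp) hu.2
  have hΦ : Φ (Ico 0 1) = 1 := by
    rw [prob_compl_eq_zero_iff measurableSet_Icc] at hΦsupp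
    rw [← Icc_sdiff_right, measure_sdiff_null hΦone, hΦsupp]
  set ν := mixtureMap Φ lam (wDist μ ξ) with hνdef
  have : IsProbabilityMeasure ν := isProbabilityMeasure_mixtureMap hlam hwm hΦ
  have hν : ν (Ico 0 1) = 1 := mixtureMap_Ico_zero_one hwm hmaps
  replace hδ : IsConvexEnvelopeOn (Icc 0 1) (fun s => ν.real (Ico 0 s)) δ :=
    hδ.congr fun s hs => by
      obtain ⟨hv, hwv⟩ := wInv_spec hξm hξpos hξint hs
      have := mixtureMap_real_Ico (Φ := Φ) hlam hw hmaps hv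
      rw [hwv] at this
      rw [this, phiMinus, Measure.real]
  refine ⟨lintegral_HstarX hν hδ hc.le, fun H hH hbudget => ?_⟩
  have hνres : ν.restrict (Ico 0 1) = ν :=
    Measure.restrict_eq_self_of_ae_mem ((prob_compl_eq_zero_iff measurableSet_Ico).2 hν)
  have hΦprob : IsProbabilityMeasure (Φ.restrict (Ico 0 1)) := ⟨by simpa using hΦ⟩
  have hvolprob : IsProbabilityMeasure ((volume : Measure ℝ).restrict (Ico 0 1)) := ⟨by simp⟩
  have hHm : MonotoneOn H (Ico 0 1) := hH.1.mono Ico_subset_Icc_self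
  have hSm : MonotoneOn (HstarX μ ξ x δ) (Ico 0 1) := monotoneOn_HstarX hδ hc.le
  have hmeas : ∀ {F : ℝ → ℝ≥0∞} (m : Measure ℝ), MonotoneOn F (Ico 0 1) →
      AEMeasurable F (m.restrict (Ico 0 1)) := fun m hF =>
    aemeasurable_restrict_of_monotoneOn measurableSet_Ico hF
  have hae : ∀ {p : ℝ → Prop} (m : Measure ℝ), (∀ u ∈ Ico (0:ℝ) 1, p u) →
      ∀ᵐ u ∂m.restrict (Ico 0 1), p u := fun m hp =>
    (ae_restrict_iff' measurableSet_Ico).2 (Filter.Eventually.of_forall hp)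
  have hHtop : ∀ u ∈ Ico (0:ℝ) 1, H (wDist μ ξ u) ≠ ⊤ := fun u hu => hH.2.1 _ (hmaps hu)
  have hStop : ∀ u ∈ Ico (0:ℝ) 1, HstarX μ ξ x δ (wDist μ ξ u) ≠ ⊤ := fun u hu => by
    rw [HstarX_of_lt_one hc.le (hmaps hu).2]
    exact ENNReal.mul_ne_top ENNReal.ofReal_ne_top ENNReal.ofReal_ne_top
  have hratio : ∀ K : ℝ → ℝ≥0∞, MonotoneOn K (Ico 0 1) → (∀ s ∈ Ico (0:ℝ) 1, K s ≠ ⊤) →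
      ENNReal.ofReal lam * (∫⁻ u in Ico 0 1, K (wDist μ ξ u) / HstarX μ ξ x δ (wDist μ ξ u)) +
        ∫⁻ u in Ico 0 1, K (wDist μ ξ u) / HstarX μ ξ x δ (wDist μ ξ u) ∂Φ ≤
      ENNReal.ofReal (1 + lam) *
        ((ENNReal.ofReal (x / ∫ ω, ξ ω ∂μ))⁻¹ * ∫⁻ s in Ico (0:ℝ) 1, K s) := by
    intro K hK hKtop
    have hdiv : AEMeasurable (fun s => K s / HstarX μ ξ x δ s) ν := by
      rw [← hνres]
      exact (hmeas ν hK).div (hmeas ν hSm)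
    rw [lintegral_mixtureMap (F := fun s => K s / HstarX μ ξ x δ s) hlam hwm hdiv]
    refine mul_le_mul_right ?_ _
    rw [← hνdef, ← hνres]
    exact lintegral_div_HstarX_le hν hδ hc hK hKtop
  have hinv := ne_top_of_le_ne_top
    (ENNReal.mul_ne_top ENNReal.ofReal_ne_top
      (ENNReal.mul_ne_top (ENNReal.inv_ne_top.2 hc0) (by simp)))
    (hratio (fun _ => 1) monotoneOn_const (by simp))
  simp only [one_div] at hinv
  have hinvΦ := (ENNReal.add_ne_top.1 hinv).2
  have hinvvol : 0 < lam →
      ∫⁻ u in Ico 0 1, (HstarX μ ξ x δ (wDist μ ξ u))⁻¹ ≠ ⊤ := fun hpos h => by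
    refine (ENNReal.add_ne_top.1 hinv).1 ?_
    rw [h, ENNReal.mul_top (by simpa using hpos)]
  have hk := hratio H hHm hH.2.1
  rw [hbudget, ENNReal.inv_mul_cancel hc0 ENNReal.ofReal_ne_top, mul_one] at hk
  have hstar : ¬ ∃ s ∈ Icc (0:ℝ) 1,
      HstarX μ ξ x δ (wDist μ ξ s) = 0 ∧ 0 < Φ (Icc 0 s) := by
    rintro ⟨s, hs, h0, hpos⟩
    have hws : wDist μ ξ s ∈ Icc (0:ℝ) 1 := by
      rw [← wDist_zero (μ := μ) (ξ := ξ), ← hw1]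
      exact ⟨hw.monotoneOn (by simp) hs hs.1, hw.monotoneOn hs (by simp) hs.2⟩
    obtain ⟨hlt, hnull⟩ := measure_Icc_of_HstarX_eq_zero hν hδ hc hws h0
    have hs1 : s < 1 := by
      rw [← hw1] at hlt
      exact (hw.lt_iff_lt hs (by simp)).1 hlt
    refine hpos.ne' (measure_mono_null ?_ (measure_eq_zero_of_mixtureMap_eq_zero hwm hnull))
    intro u hu
    have hu' : u ∈ Ico (0:ℝ) 1 := ⟨hu.1, hu.2.trans_lt hs1⟩
    exact ⟨⟨(hmaps hu').1, hw.monotoneOn (Ico_subset_Icc_self hu') hs hu.2⟩, hu'⟩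
  have hHw : MonotoneOn (fun u => H (wDist μ ξ u)) (Ico 0 1) := hHm.comp hwm hmaps
  have hSw : MonotoneOn (fun u => HstarX μ ξ x δ (wDist μ ξ u)) (Ico 0 1) := hSm.comp hwm hmaps
  unfold Jfun
  rw [if_neg hstar]
  split_ifs
  · simp
  · exact weighted_sub_le_weighted_sub hlam
      (fun hpos => lintegral_erealPos_log_add_le (hmeas _ hHw) (hmeas _ hSw) (hae _ hHtop)
        (hae _ hStop) (hinvvol hpos))
      (lintegral_erealPos_log_add_le (hmeas _ hHw) (hmeas _ hSw) (hae _ hHtop)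
        (hae _ hStop) hinvΦ)
      (fun hpos => lintegral_erealPos_neg_log_ne_top (hae _ hStop) (hinvvol hpos))
      (lintegral_erealPos_neg_log_ne_top (hae _ hStop) hinvΦ) hk

end
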